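/- arXiv:1611.10279 — 5 statements merged into one kernel-verified Lean document; each statement's English description precedes it below -/
import Mathlib

section
/- (Carry propagation for blocks of growing size.) Let q ≥ 2 be an integer and P : ℕ → ℕ nondecreasing. Let ρ, λ, κ be nonnegative integers with P(λ+κ+1) ≤ ρ and ρ ≤ (3/4)·λ. Let B be the set of integers l with 0 ≤ l < q^λ for which there exist integers k₁, k₂ with 0 ≤ k₁, k₂ < q^κ such that the integer difference a_P(l·q^κ + k₁ + k₂) − a_P(l·q^κ + k₁) differs from a_P^{(κ+ρ)}(l·q^κ + k₁ + k₂) − a_P^{(κ+ρ)}(l·q^κ + k₁). Then there is a constant C > 0 depending only on q such that #B ≤ C·q^{λ − ρ + P(λ+κ+1)}. -/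
open Finset

open scoped Classical

noncomputable section

/-- the `i`-th digit of `n` in base `q` -/
def dig (q i n : ℕ) : ℕ := n / q ^ i % q

/-- `a_P(x,y) = ∑_{i ≥ 0} ε_{i+P(y)}(x) ⋯ ε_i(x)` : number of blocks of `P(y)+1`
consecutive base-`q` digits of `x` all equal to `q-1`-products, i.e. products of
`P(y)+1` consecutive digits of `x`, starting at `i`.  (All summands with `i > x`
vanish, so the range is large enough.) -/
def aP (q : ℕ) (P : ℕ → ℕ) (x y : ℕ) : ℕ :=
  ∑ i ∈ Finset.range (x + 1), ∏ j ∈ Finset.range (P y + 1), dig q (i + j) x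

/-- `a_P(n) = a_P(n, T_q(n))` where `T_q(n) = ⌊log n / log q⌋ = Nat.log q n`. -/
def aP1 (q : ℕ) (P : ℕ → ℕ) (n : ℕ) : ℕ := aP q P n (Nat.log q n)

/-- `e(t) = exp(2πit)` -/
def e (t : ℝ) : ℂ := Complex.exp (2 * Real.pi * Complex.I * t)

/-- `f_P(n) = e(α a_P(n))` -/
def fP1 (q : ℕ) (P : ℕ → ℕ) (α : ℝ) (n : ℕ) : ℂ := e (α * aP1 q P n)

/-- `γ_P(l,k)`, where `|α - round α|` is the distance from `α` to the nearest integer. -/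
def gammaP (q : ℕ) (P : ℕ → ℕ) (α : ℝ) (l : ℝ) (k : ℕ) : ℝ :=
  l * (1 - Real.log ((q : ℝ) ^ P k - 8 * Real.sin (Real.pi * |α - (round α : ℝ)| / 4) ^ 2)
        / ((P k : ℝ) * Real.log q))

/-- the constant `c₁(q)` -/
def c1 (q : ℕ) : ℝ :=
  (q : ℝ) ^ ((13 : ℝ) / 64) * max (Real.log q ^ 3) ((q.divisors.card : ℝ) ^ ((1 : ℝ) / 4)) *
    Real.log q ^ (-(3 : ℝ) - (q.primeFactors.card : ℝ) / 4)

/-- the truncated block counting function `a_P^{(ρ)}(n) = a_P(n mod q^ρ, T_q(n))` -/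
def aPt (q : ℕ) (P : ℕ → ℕ) (ρ n : ℕ) : ℕ := aP q P (n % q ^ ρ) (Nat.log q n)

/-- The digits of `n` from position `s` on depend only on `n / q ^ s`. -/
lemma dig_eq_of_div_eq {q s i n₁ n₂ : ℕ} (hsi : s ≤ i) (h : n₁ / q ^ s = n₂ / q ^ s) :
    dig q i n₁ = dig q i n₂ := by
  obtain ⟨k, rfl⟩ := Nat.exists_eq_add_of_le hsi
  simp only [dig, pow_add, ← Nat.div_div_eq_div_mul, h]

lemma dig_mod_of_lt {q r i n : ℕ} (hir : i < r) : dig q i (n % q ^ r) = dig q i n := by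
  obtain ⟨k, rfl⟩ := Nat.exists_eq_add_of_lt hir
  unfold dig
  rw [add_assoc, pow_add, Nat.mod_mul_right_div_self,
    Nat.mod_mod_of_dvd _ (dvd_pow_self q (by omega))]

lemma dig_of_lt_pow {q r i n : ℕ} (hq : 0 < q) (hn : n < q ^ r) (hri : r ≤ i) :
    dig q i n = 0 := by
  unfold dig
  rw [Nat.div_eq_of_lt (hn.trans_le (Nat.pow_le_pow_right hq hri)), Nat.zero_mod]

lemma aP_eq_sum_range {q : ℕ} (hq : 2 ≤ q) (P : ℕ → ℕ) (y : ℕ) {x N : ℕ} (hN : x < N) :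
    aP q P x y = ∑ i ∈ range N, ∏ j ∈ range (P y + 1), dig q (i + j) x := by
  unfold aP
  refine sum_subset (range_subset_range.2 hN) fun i _ hi => ?_
  refine prod_eq_zero (mem_range.2 (Nat.succ_pos (P y))) ?_
  refine dig_of_lt_pow (by omega) (Nat.lt_pow_self hq) ?_
  simpa using (Nat.le_of_succ_le (by simpa using hi) : x ≤ i)

/-- Truncation at `r` only removes the blocks reaching a position `≥ r`. -/
lemma aP_sub_aP_mod {q : ℕ} (hq : 2 ≤ q) (P : ℕ → ℕ) (y r : ℕ) {x N : ℕ} (hN : x < N) :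
    (aP q P x y : ℤ) - aP q P (x % q ^ r) y =
      ∑ i ∈ range N, if i + P y < r then (0 : ℤ)
        else ∏ j ∈ range (P y + 1), (dig q (i + j) x : ℤ) := by
  rw [aP_eq_sum_range hq P y hN, aP_eq_sum_range hq P y ((Nat.mod_le x (q ^ r)).trans_lt hN)]
  push_cast
  rw [← sum_sub_distrib]
  refine sum_congr rfl fun i _ => ?_
  split_ifs with h
  · rw [sub_eq_zero]
    refine prod_congr rfl fun j hj => ?_
    have := mem_range.1 hj
    rw [dig_mod_of_lt (by omega)]
  · rw [prod_eq_zero (i := P y) (f := fun j => (dig q (i + j) (x % q ^ r) : ℤ)) (by simp), sub_zero]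
    rw [dig_of_lt_pow (by omega) (Nat.mod_lt _ (by positivity)) (by omega), Nat.cast_zero]

lemma aP_sub_aP_mod_congr {q : ℕ} (hq : 2 ≤ q) (P : ℕ → ℕ) {y r n₁ n₂ : ℕ}
    (h : n₁ / q ^ (r - P y) = n₂ / q ^ (r - P y)) :
    (aP q P n₁ y : ℤ) - aP q P (n₁ % q ^ r) y = aP q P n₂ y - aP q P (n₂ % q ^ r) y := by
  rw [aP_sub_aP_mod hq P y r (show n₁ < n₁ + n₂ + 1 by omega),
    aP_sub_aP_mod hq P y r (show n₂ < n₁ + n₂ + 1 by omega)]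
  refine sum_congr rfl fun i _ => ?_
  split_ifs with hi
  · rfl
  · refine prod_congr rfl fun j _ => ?_
    rw [dig_eq_of_div_eq (by omega) h]

/-- If `⌊log_q⌋` jumps between `l q ^ κ + k₁` and `l q ^ κ + k₁ + k₂`, then `l + 1` is a
power of `q`. -/
lemma exists_eq_pow_sub_one_of_log_ne {q lam kap l k₁ k₂ : ℕ} (hq : 2 ≤ q) (hl : l < q ^ lam)
    (hk₁ : k₁ < q ^ kap) (hk₂ : k₂ < q ^ kap)
    (h : Nat.log q (l * q ^ kap + k₁ + k₂) ≠ Nat.log q (l * q ^ kap + k₁)) :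
    ∃ s < lam + 1, q ^ s - 1 = l := by
  set n₁ := l * q ^ kap + k₁ with hn₁
  have hlt : Nat.log q n₁ < Nat.log q (n₁ + k₂) :=
    lt_of_le_of_ne (Nat.log_mono_right (Nat.le_add_right _ _)) h.symm
  have hne : n₁ + k₂ ≠ 0 := by
    intro h0
    simp [h0] at hlt
  have hlow : n₁ < q ^ Nat.log q (n₁ + k₂) := Nat.lt_pow_of_log_lt (by omega) hlt
  have hup : q ^ Nat.log q (n₁ + k₂) ≤ n₁ + k₂ := Nat.pow_log_le_self q hne
  generalize Nat.log q (n₁ + k₂) = s at hlow hup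
  rcases le_total s kap with hs | hs
  · refine ⟨0, by omega, ?_⟩
    have h1 : n₁ < q ^ kap := hlow.trans_le (Nat.pow_le_pow_right (by omega) hs)
    have h2 : l * q ^ kap < 1 * q ^ kap := by omega
    have h3 := Nat.lt_of_mul_lt_mul_right h2
    simp; omega
  · obtain ⟨t, rfl⟩ := Nat.exists_eq_add_of_le' hs
    rw [pow_add] at hlow hup
    have h1 : l < q ^ t := Nat.lt_of_mul_lt_mul_right (a := q ^ kap) (by omega)
    have h2 : q ^ t < l + 2 := by
      refine Nat.lt_of_mul_lt_mul_right (a := q ^ kap) ?_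
      rw [add_mul]
      omega
    refine ⟨t, ?_, by omega⟩
    have h3 : q ^ t ≤ q ^ lam := by omega
    exact Nat.lt_succ_of_le ((Nat.pow_le_pow_iff_right (by omega)).1 h3)

/-- An exceptional `l` either propagates a carry through `ρ - P (lam + kap + 1)` digits, or
makes `⌊log_q⌋` jump. -/
lemma dvd_succ_or_exists_eq_pow_sub_one {q : ℕ} (hq : 2 ≤ q) {P : ℕ → ℕ} (hP : Monotone P)
    {ρ lam kap l k₁ k₂ : ℕ} (hρ : P (lam + kap + 1) ≤ ρ) (hl : l < q ^ lam)
    (hk₁ : k₁ < q ^ kap) (hk₂ : k₂ < q ^ kap)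
    (h : (aP1 q P (l * q ^ kap + k₁ + k₂) : ℤ) - (aP1 q P (l * q ^ kap + k₁) : ℤ) ≠
      (aPt q P (kap + ρ) (l * q ^ kap + k₁ + k₂) : ℤ) -
        (aPt q P (kap + ρ) (l * q ^ kap + k₁) : ℤ)) :
    q ^ (ρ - P (lam + kap + 1)) ∣ l + 1 ∨ ∃ s < lam + 1, q ^ s - 1 = l := by
  by_cases hlog : Nat.log q (l * q ^ kap + k₁ + k₂) = Nat.log q (l * q ^ kap + k₁)
  swap
  · exact Or.inr (exists_eq_pow_sub_one_of_log_ne hq hl hk₁ hk₂ hlog)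
  left
  by_contra hdvd
  apply h
  unfold aP1 aPt
  rw [hlog]
  set y := Nat.log q (l * q ^ kap + k₁) with hy
  have hpos : 0 < q ^ kap := by positivity
  have hylt : y ≤ lam + kap + 1 := by
    rw [hy, ← Nat.log_pow (show 1 < q by omega) (lam + kap + 1)]
    refine Nat.log_mono_right ?_
    have h1 : (l + 1) * q ^ kap ≤ q ^ lam * q ^ kap := Nat.mul_le_mul_right _ hl
    have h2 : q ^ lam * q ^ kap ≤ q ^ (lam + kap + 1) := by
      rw [← pow_add]
      exact Nat.pow_le_pow_right (by omega) (by omega)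
    rw [add_mul] at h1
    omega
  have hPy : P y ≤ P (lam + kap + 1) := hP hylt
  have hdvd' : ¬ q ^ (ρ - P y) ∣ l + 1 := fun hd =>
    hdvd ((pow_dvd_pow q (by omega)).trans hd)
  have hdiv : (l * q ^ kap + k₁) / q ^ (kap + ρ - P y) =
      (l * q ^ kap + k₁ + k₂) / q ^ (kap + ρ - P y) := by
    rw [Nat.add_sub_assoc (hPy.trans hρ), pow_add, ← Nat.div_div_eq_div_mul,
      ← Nat.div_div_eq_div_mul, add_assoc, mul_comm l, Nat.mul_add_div hpos,
      Nat.mul_add_div hpos, Nat.div_eq_of_lt hk₁, add_zero]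
    have hcarry : (k₁ + k₂) / q ^ kap < 2 := Nat.div_lt_of_lt_mul (by omega)
    obtain hc | hc : (k₁ + k₂) / q ^ kap = 0 ∨ (k₁ + k₂) / q ^ kap = 1 :=
      Nat.le_one_iff_eq_zero_or_eq_one.1 (Nat.le_of_lt_succ hcarry)
    · rw [hc, add_zero]
    · rw [hc]
      exact (Nat.succ_div_of_not_dvd hdvd').symm
  have := aP_sub_aP_mod_congr hq P hdiv
  linarith

lemma card_filter_pow_dvd_succ_le {q a b : ℕ} (hq : 2 ≤ q) (hab : a ≤ b) :
    #{l ∈ range (q ^ b) | q ^ a ∣ l + 1} ≤ q ^ (b - a) := by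
  have hsub : {l ∈ range (q ^ b) | q ^ a ∣ l + 1} ⊆
      (Icc 1 (q ^ (b - a))).image (fun c => q ^ a * c - 1) := by
    intro l hl
    simp only [mem_filter, mem_range] at hl
    obtain ⟨hlb, c, hc⟩ := hl
    rw [mem_image]
    refine ⟨c, mem_Icc.2 ⟨Nat.pos_of_ne_zero ?_, ?_⟩, by omega⟩
    · rintro rfl
      simp at hc
    · refine le_of_mul_le_mul_left (a := q ^ a) ?_ (by positivity)
      rw [← pow_add, Nat.add_sub_cancel' hab]
      omega
  simpa using (card_le_card hsub).trans card_image_le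

lemma succ_le_eight_mul_rpow {q : ℕ} (hq : 2 ≤ q) {n : ℕ} {x : ℝ} (hx : (n : ℝ) / 4 ≤ x) :
    (n : ℝ) + 1 ≤ 8 * (q : ℝ) ^ x := by
  have hq' : (2 : ℝ) ≤ q := by exact_mod_cast hq
  have hn : (0 : ℝ) ≤ n := n.cast_nonneg
  have h1 : (2 : ℝ) ^ ((n : ℝ) / 4) ≤ (q : ℝ) ^ x :=
    (Real.rpow_le_rpow (by norm_num) hq' (by positivity)).trans
      (Real.rpow_le_rpow_of_exponent_le (by linarith) hx)
  have h2 : Real.log 2 * ((n : ℝ) / 4) + 1 ≤ (2 : ℝ) ^ ((n : ℝ) / 4) := by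
    rw [Real.rpow_def_of_pos (by norm_num)]
    exact Real.add_one_le_exp _
  nlinarith [Real.log_two_gt_d9]

/-- Carry propagation property for blocks of growing size. -/
theorem carry_propagation (q : ℕ) (hq : 2 ≤ q) :
    ∃ C : ℝ, 0 < C ∧ ∀ (P : ℕ → ℕ), Monotone P →
      ∀ ρ lam kap : ℕ, P (lam + kap + 1) ≤ ρ → (ρ : ℝ) ≤ 3 / 4 * (lam : ℝ) →
      ({l : ℕ | l < q ^ lam ∧ ∃ k₁ < q ^ kap, ∃ k₂ < q ^ kap,
          (aP1 q P (l * q ^ kap + k₁ + k₂) : ℤ) - (aP1 q P (l * q ^ kap + k₁) : ℤ) ≠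
            (aPt q P (kap + ρ) (l * q ^ kap + k₁ + k₂) : ℤ) -
              (aPt q P (kap + ρ) (l * q ^ kap + k₁) : ℤ)}.ncard : ℝ) ≤
        C * (q : ℝ) ^ ((lam : ℝ) - (ρ : ℝ) + (P (lam + kap + 1) : ℝ)) := by
  refine ⟨9, by norm_num, fun P hP ρ lam kap hρ hlam => ?_⟩
  have hρlam : ρ ≤ lam := by
    have : (0 : ℝ) ≤ lam := lam.cast_nonneg
    exact_mod_cast (show (ρ : ℝ) ≤ lam by linarith)
  set M := P (lam + kap + 1) with hM
  set A : Finset ℕ := {l ∈ range (q ^ lam) | q ^ (ρ - M) ∣ l + 1} with hA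
  set D : Finset ℕ := (range (lam + 1)).image (fun s => q ^ s - 1) with hD
  have hexp : ((lam - (ρ - M) : ℕ) : ℝ) = (lam : ℝ) - ρ + M := by
    rw [Nat.cast_sub (by omega), Nat.cast_sub hρ]
    ring
  have hAcard : (#A : ℝ) ≤ (q : ℝ) ^ ((lam : ℝ) - ρ + M) := by
    rw [← hexp, Real.rpow_natCast]
    exact_mod_cast card_filter_pow_dvd_succ_le hq (by omega)
  have hDcard : (#D : ℝ) ≤ 8 * (q : ℝ) ^ ((lam : ℝ) - ρ + M) := by
    refine le_trans ?_ (succ_le_eight_mul_rpow hq (n := lam) ?_)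
    · exact_mod_cast card_image_le.trans (card_range _).le
    · have : (0 : ℝ) ≤ M := M.cast_nonneg
      linarith
  calc _ ≤ ((#(A ∪ D) : ℕ) : ℝ) := by
        rw [← Set.ncard_coe_finset]
        refine Nat.cast_le.2 (Set.ncard_le_ncard ?_ (finite_toSet _))
        rintro l ⟨hl, k₁, hk₁, k₂, hk₂, h⟩
        rw [mem_coe, mem_union, hA, hD, mem_filter, mem_range, mem_image]
        rcases dvd_succ_or_exists_eq_pow_sub_one hq hP hρ hl hk₁ hk₂ h with h | ⟨s, hs, h⟩
        · exact Or.inl ⟨hl, h⟩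
        · exact Or.inr ⟨s, mem_range.2 hs, h⟩
    _ ≤ #A + #D := by exact_mod_cast card_union_le A D
    _ ≤ 9 * (q : ℝ) ^ ((lam : ℝ) - ρ + M) := by linarith
end
end

section
/- (First truncation.) Let q ≥ 2 be an integer, α ∈ ℝ, and P : ℕ → ℕ nondecreasing. Let μ, ν, ρ be nonnegative integers with 2ρ < ν and P(μ+ν) ≤ ρ. Let E be the set of pairs (m,n) with q^{μ−2} ≤ m < q^μ and q^{ν−2} ≤ n < q^ν for which there exists an integer k with 0 ≤ k < q^{μ+ρ} such that f_P(mn+k)·conj(f_P(mn)) ≠ f_P^{(μ+2ρ)}(mn+k)·conj(f_P^{(μ+2ρ)}(mn)). Then there is a constant C > 0 depending only on q such that #E ≤ C·(log q)·q^{μ+ν−ρ+P(μ+ν+1)}. -/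
open Finset

open scoped Classical

noncomputable section

/-- the truncated function `f_P^{(ρ)}(n) = e(α a_P(n mod q^ρ, T_q(n)))` -/
def fPt (q : ℕ) (P : ℕ → ℕ) (α : ℝ) (ρ n : ℕ) : ℂ :=
  e (α * aP q P (n % q ^ ρ) (Nat.log q n))

/-- A block of consecutive digits of `x` starting at `i`. -/
def digitBlock (q p x i : ℕ) : ℕ := ∏ j ∈ Finset.range (p + 1), dig q (i + j) x

theorem dig_eq_zero_of_le {q : ℕ} (hq : 2 ≤ q) {x i : ℕ} (h : x ≤ i) : dig q i x = 0 := by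
  have : x < q ^ i := lt_of_le_of_lt h (Nat.lt_pow_self (by omega))
  simp [dig, Nat.div_eq_of_lt this]

theorem aP_eq_sum_digitBlock {q : ℕ} (hq : 2 ≤ q) (P : ℕ → ℕ) {x y K : ℕ} (hK : x < K) :
    aP q P x y = ∑ i ∈ Finset.range K, digitBlock q (P y) x i := by
  unfold aP
  refine Finset.sum_subset (fun i hi => ?_) (fun i _ hi => ?_)
  · simp only [Finset.mem_range] at *
    omega
  · refine Finset.prod_eq_zero (i := 0) (by simp) (dig_eq_zero_of_le hq ?_)
    simp only [Finset.mem_range] at hi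
    omega

theorem dig_mod_of_lt_s12 {q i L : ℕ} (x : ℕ) (h : i < L) : dig q i (x % q ^ L) = dig q i x := by
  obtain ⟨d, rfl⟩ : ∃ d, L = i + (d + 1) := ⟨L - i - 1, by omega⟩
  unfold dig
  rw [pow_add, Nat.mod_mul_right_div_self, Nat.mod_mod_of_dvd _ (dvd_pow_self q (by omega))]

theorem dig_mod_of_le {q i L : ℕ} (hq : 2 ≤ q) (x : ℕ) (h : L ≤ i) :
    dig q i (x % q ^ L) = 0 := by
  have h1 : x % q ^ L < q ^ i :=
    lt_of_lt_of_le (Nat.mod_lt _ (by positivity)) (Nat.pow_le_pow_right (by omega) h)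
  simp [dig, Nat.div_eq_of_lt h1]

theorem dig_congr_of_div_eq {q M i x x' : ℕ} (h : x / q ^ M = x' / q ^ M) (hi : M ≤ i) :
    dig q i x = dig q i x' := by
  obtain ⟨d, rfl⟩ := Nat.exists_eq_add_of_le hi
  unfold dig
  rw [pow_add, ← Nat.div_div_eq_div_mul, ← Nat.div_div_eq_div_mul, h]

theorem digitBlock_truncation {q M L p x x' : ℕ} (hq : 2 ≤ q)
    (h : x / q ^ M = x' / q ^ M) (hp : M + p ≤ L) (i : ℕ) :
    digitBlock q p x i + digitBlock q p (x' % q ^ L) i =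
      digitBlock q p x' i + digitBlock q p (x % q ^ L) i := by
  unfold digitBlock
  rcases lt_or_ge (i + p) L with hi | hi
  · have key : ∀ z, ∏ j ∈ Finset.range (p + 1), dig q (i + j) (z % q ^ L) =
        ∏ j ∈ Finset.range (p + 1), dig q (i + j) z := fun z =>
      Finset.prod_congr rfl fun j hj => dig_mod_of_lt_s12 z (by
        simp only [Finset.mem_range] at hj
        omega)
    rw [key, key, add_comm]
  · congr 1
    · exact Finset.prod_congr rfl fun j _ => dig_congr_of_div_eq h (by omega)
    · refine Finset.prod_congr rfl fun j _ => ?_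
      rcases lt_or_ge (i + j) L with hj | hj
      · rw [dig_mod_of_lt_s12 _ hj, dig_mod_of_lt_s12 _ hj, dig_congr_of_div_eq h (by omega)]
      · rw [dig_mod_of_le hq _ hj, dig_mod_of_le hq _ hj]

theorem aP_truncation {q M L x x' y : ℕ} (hq : 2 ≤ q) (P : ℕ → ℕ)
    (h : x / q ^ M = x' / q ^ M) (hp : M + P y ≤ L) :
    aP q P x y + aP q P (x' % q ^ L) y = aP q P x' y + aP q P (x % q ^ L) y := by
  have h1 : x % q ^ L ≤ x := Nat.mod_le _ _
  have h2 : x' % q ^ L ≤ x' := Nat.mod_le _ _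
  rw [aP_eq_sum_digitBlock hq P (x := x) (K := x + x' + 1) (by omega),
    aP_eq_sum_digitBlock hq P (x := x') (K := x + x' + 1) (by omega),
    aP_eq_sum_digitBlock hq P (x := x % q ^ L) (K := x + x' + 1) (by omega),
    aP_eq_sum_digitBlock hq P (x := x' % q ^ L) (K := x + x' + 1) (by omega),
    ← Finset.sum_add_distrib, ← Finset.sum_add_distrib]
  exact Finset.sum_congr rfl fun i _ => digitBlock_truncation hq h hp i

theorem e_mul_conj_e (s t : ℝ) : e s * (starRingEnd ℂ) (e t) = e (s - t) := by
  unfold e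
  rw [← Complex.exp_conj, ← Complex.exp_add]
  have h2 : (starRingEnd ℂ) 2 = 2 := Complex.conj_ofNat 2
  congr 1
  simp only [map_mul, h2, Complex.conj_ofReal, Complex.conj_I, Complex.ofReal_sub]
  ring

theorem log_eq_of_div_pow_eq {q M x x' : ℕ} (hq : 2 ≤ q) (hM : q ^ M ≤ x)
    (h : x / q ^ M = x' / q ^ M) : Nat.log q x = Nat.log q x' := by
  have hpos : 0 < q ^ M := by positivity
  have hM' : q ^ M ≤ x' := by
    have : 0 < x / q ^ M := Nat.div_pos hM hpos
    rw [h] at this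
    exact (Nat.div_pos_iff.mp this).2
  have e1 := Nat.log_div_base_pow q x M
  have e2 := Nat.log_div_base_pow q x' M
  have l1 : M ≤ Nat.log q x := Nat.le_log_of_pow_le (by omega) hM
  have l2 : M ≤ Nat.log q x' := Nat.le_log_of_pow_le (by omega) hM'
  rw [h] at e1
  omega

/-- Truncation is harmless when `x` and `x'` agree on all digits from position `M` on. -/
theorem fP1_mul_conj_eq_fPt_mul_conj {q M L x x' : ℕ} (hq : 2 ≤ q) (P : ℕ → ℕ) (α : ℝ)
    (h : x / q ^ M = x' / q ^ M) (hp : M + P (Nat.log q x) ≤ L) :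
    fP1 q P α x' * (starRingEnd ℂ) (fP1 q P α x) =
      fPt q P α L x' * (starRingEnd ℂ) (fPt q P α L x) := by
  have hpos : 0 < q ^ M := by positivity
  rcases lt_or_ge x (q ^ M) with hx | hx
  · have hx' : x' < q ^ M := by
      rw [Nat.div_eq_of_lt hx] at h
      rcases Nat.div_eq_zero_iff.mp h.symm with h0 | h0 <;> omega
    have hML : q ^ M ≤ q ^ L := Nat.pow_le_pow_right (by omega) (by omega)
    unfold fP1 fPt aP1
    rw [Nat.mod_eq_of_lt (by omega : x < q ^ L), Nat.mod_eq_of_lt (by omega : x' < q ^ L)]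
  · unfold fP1 fPt aP1
    rw [← log_eq_of_div_pow_eq hq hx h, e_mul_conj_e, e_mul_conj_e]
    congr 1
    have key := congrArg (Nat.cast : ℕ → ℝ) (aP_truncation hq P h hp)
    push_cast at key
    linear_combination -α * key

/-- If adding `k` changes the quotient by `Q`, then the residue is within `k` of `Q`. -/
theorem le_mod_add_of_div_ne {x k Q : ℕ} (h : x / Q ≠ (x + k) / Q) : Q ≤ x % Q + k := by
  by_contra! hlt
  apply h
  rcases Nat.eq_zero_or_pos Q with rfl | hQ
  · simp
  · have h1 : x + k = (x % Q + k) + Q * (x / Q) := by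
      have := Nat.mod_add_div x Q
      omega
    conv_rhs => rw [h1]
    rw [Nat.add_mul_div_left _ _ hQ, Nat.div_eq_of_lt hlt, zero_add]

/-- The `n < N` for which `m * n` lies less than `R` below a multiple of `Q`. -/
theorem card_filter_mod_near_le {m N Q R D J : ℕ} (hR : R ≤ D * m) (hJ : m * N ≤ J * Q) :
    ((Finset.range N).filter fun n => Q < m * n % Q + R).card ≤ D * J := by
  rcases Nat.eq_zero_or_pos m with rfl | hm
  · have hR0 : R = 0 := by simpa using hR
    simp [hR0]
  rcases Nat.eq_zero_or_pos Q with rfl | hQ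
  · have : N = 0 := by
      simp only [mul_zero, Nat.le_zero, Nat.mul_eq_zero] at hJ
      omega
    simp [this]
  refine (Finset.card_le_mul_card_image (f := fun n => m * n / Q) _ D ?_).trans ?_
  · intro j _
    set F := ((Finset.range N).filter fun n => Q < m * n % Q + R).filter
      fun n => m * n / Q = j with hF
    rcases F.eq_empty_or_nonempty with h0 | hne
    · simp [h0]
    · obtain ⟨a, ha, hmin⟩ := F.exists_min_image id hne
      have hsub : F ⊆ Finset.Ico a (a + D) := by
        intro b hb
        have hab : a ≤ b := hmin b hb
        simp only [hF, Finset.mem_filter] at ha hb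
        refine Finset.mem_Ico.mpr ⟨hab, ?_⟩
        have ea := Nat.mod_add_div (m * a) Q
        have eb := Nat.mod_add_div (m * b) Q
        rw [ha.2] at ea
        rw [hb.2] at eb
        have hbQ : m * b % Q < Q := Nat.mod_lt _ hQ
        have : m * b < m * a + R := by omega
        have : m * b < m * (a + D) := by nlinarith
        exact Nat.lt_of_mul_lt_mul_left this
      simpa using Finset.card_le_card hsub
  · refine Nat.mul_le_mul_left D ?_
    have hsub : ((Finset.range N).filter fun n => Q < m * n % Q + R).image
        (fun n => m * n / Q) ⊆ Finset.range J := by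
      intro j hj
      obtain ⟨n, hn, rfl⟩ := Finset.mem_image.mp hj
      have hn' : n < N := Finset.mem_range.mp (Finset.mem_filter.mp hn).1
      rw [Finset.mem_range, Nat.div_lt_iff_lt_mul hQ]
      exact lt_of_lt_of_le (Nat.mul_lt_mul_of_pos_left hn' hm) hJ
    simpa using Finset.card_le_card hsub

/-- Counting pairs whose product lies less than `q ^ (μ + ρ)` below a multiple of `q ^ M`. -/
theorem card_pairs_mod_near_le {q μ ν ρ M : ℕ} (hq : 0 < q) (hM : M ≤ μ + ν) :
    (((Finset.range (q ^ μ)).filter fun m => q ^ (μ - 2) ≤ m).sigma fun m =>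
      (Finset.range (q ^ ν)).filter fun n => q ^ M < m * n % q ^ M + q ^ (μ + ρ)).card ≤
      q ^ μ * (q ^ (2 + ρ) * q ^ (μ + ν - M)) := by
  rw [Finset.card_sigma]
  refine (Finset.sum_le_card_nsmul _ _ (q ^ (2 + ρ) * q ^ (μ + ν - M)) ?_).trans ?_
  · intro m hm
    simp only [Finset.mem_filter, Finset.mem_range] at hm
    refine card_filter_mod_near_le ?_ ?_
    · calc q ^ (μ + ρ) ≤ q ^ (2 + ρ + (μ - 2)) := Nat.pow_le_pow_right hq (by omega)
        _ = q ^ (2 + ρ) * q ^ (μ - 2) := pow_add _ _ _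
        _ ≤ _ := Nat.mul_le_mul_left _ hm.2
    · rw [← pow_add, Nat.sub_add_cancel hM, pow_add]
      exact Nat.mul_le_mul_right _ hm.1.le
  · rw [smul_eq_mul]
    refine Nat.mul_le_mul_right _ ?_
    simpa using Finset.card_filter_le (Finset.range (q ^ μ)) fun m => q ^ (μ - 2) ≤ m

/-- First truncation: counting the pairs where the truncation at `μ+2ρ` differs. -/
theorem first_truncation (q : ℕ) (hq : 2 ≤ q) :
    ∃ C : ℝ, 0 < C ∧ ∀ (α : ℝ) (P : ℕ → ℕ), Monotone P →
      ∀ μ ν ρ : ℕ, 2 * ρ < ν → P (μ + ν) ≤ ρ →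
      ({p : ℕ × ℕ | q ^ (μ - 2) ≤ p.1 ∧ p.1 < q ^ μ ∧ q ^ (ν - 2) ≤ p.2 ∧ p.2 < q ^ ν ∧
          ∃ k < q ^ (μ + ρ),
            fP1 q P α (p.1 * p.2 + k) * (starRingEnd ℂ) (fP1 q P α (p.1 * p.2)) ≠
              fPt q P α (μ + 2 * ρ) (p.1 * p.2 + k) *
                (starRingEnd ℂ) (fPt q P α (μ + 2 * ρ) (p.1 * p.2))}.ncard : ℝ) ≤
        C * Real.log q * (q : ℝ) ^ ((μ : ℝ) + (ν : ℝ) - (ρ : ℝ) + (P (μ + ν + 1) : ℝ)) := by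
  have hq1 : (1 : ℝ) < q := by exact_mod_cast hq
  have hlog : 0 < Real.log q := Real.log_pos hq1
  refine ⟨(q : ℝ) ^ 2 / Real.log q, by positivity, ?_⟩
  intro α P hP μ ν ρ hρ hPρ
  rw [div_mul_cancel₀ _ hlog.ne']
  set M := μ + 2 * ρ - P (μ + ν) with hM
  set S := ((Finset.range (q ^ μ)).filter fun m => q ^ (μ - 2) ≤ m).sigma fun m =>
    (Finset.range (q ^ ν)).filter fun n => q ^ M < m * n % q ^ M + q ^ (μ + ρ) with hS
  have hcard : S.card ≤ q ^ μ * (q ^ (2 + ρ) * q ^ (μ + ν - M)) :=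
    card_pairs_mod_near_le (by omega) (by omega)
  refine le_trans (b := ((q ^ μ * (q ^ (2 + ρ) * q ^ (μ + ν - M)) : ℕ) : ℝ)) ?_ ?_
  · refine Nat.cast_le.mpr (le_trans ?_ ((Finset.card_image_le
      (f := fun s : (_ : ℕ) × ℕ => (s.1, s.2))).trans hcard))
    rw [← Set.ncard_coe_finset]
    refine Set.ncard_le_ncard ?_ (Finset.finite_toSet _)
    rintro ⟨m, n⟩ ⟨hm1, hm2, -, hn2, k, hk, hne⟩
    simp only at hm1 hm2 hn2 hne
    refine Finset.mem_coe.mpr (Finset.mem_image.mpr ⟨⟨m, n⟩, ?_, rfl⟩)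
    have hmn : m * n < q ^ (μ + ν) := by
      rw [pow_add]
      exact Nat.mul_lt_mul'' hm2 hn2
    have hlogle : Nat.log q (m * n) ≤ μ + ν := by
      simpa [Nat.log_pow (by omega : 1 < q)] using Nat.log_mono_right (b := q) hmn.le
    have hPle := hP hlogle
    have hdiv : m * n / q ^ M ≠ (m * n + k) / q ^ M := fun h =>
      hne (fP1_mul_conj_eq_fPt_mul_conj hq P α h (by omega))
    have := le_mod_add_of_div_ne hdiv
    simp only [hS, Finset.mem_sigma, Finset.mem_filter, Finset.mem_range]
    exact ⟨⟨hm2, hm1⟩, hn2, by omega⟩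
  · have hexp : q ^ μ * (q ^ (2 + ρ) * q ^ (μ + ν - M)) =
        q ^ 2 * q ^ (μ + ν - ρ + P (μ + ν)) := by
      rw [← pow_add, ← pow_add, ← pow_add]
      congr 1
      omega
    rw [hexp]
    push_cast
    refine mul_le_mul_of_nonneg_left ?_ (by positivity)
    rw [← Real.rpow_natCast]
    refine Real.rpow_le_rpow_of_exponent_le hq1.le ?_
    have hmono : (P (μ + ν) : ℝ) ≤ P (μ + ν + 1) := by exact_mod_cast hP (Nat.le_succ _)
    push_cast [Nat.cast_sub (by omega : ρ ≤ μ + ν)]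
    linarith
end
end

section
/- (Non-automaticity.) Let q = 2 and let P : ℕ → ℕ be nondecreasing and unbounded with P(n) ≤ log n/log 2 for all n ≥ 2. Then there is no deterministic finite automaton over the alphabet {0,1} with finitely many states recognizing the parity of a_P: that is, there do not exist a finite type σ and a DFA M with state space σ and input alphabet {0,1} such that for every finite word w over {0,1}, M accepts w if and only if a_P(n_w) is even, where n_w := ∑_{0 ≤ j < |w|} w_j·2^{|w|−1−j} is the integer whose binary expansion, read most significant bit first (leading zeros allowed), is w. In particular the sequence ((−1)^{a_P(n)})_{n≥0} is not 2-automatic. -/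
open Finset

open scoped Classical

noncomputable section

/-- the integer whose binary expansion, most significant bit first, is the word `w` -/
def wordToNat (w : List Bool) : ℕ :=
  w.foldl (fun acc b => 2 * acc + (if b then 1 else 0)) 0

theorem wordToNat_append (u v : List Bool) :
    wordToNat (u ++ v) = wordToNat u * 2 ^ v.length + wordToNat v := by
  induction v using List.reverseRecOn with
  | nil => simp [wordToNat]
  | append_singleton v b ih =>
    have snoc : ∀ x : List Bool,
        wordToNat (x ++ [b]) = 2 * wordToNat x + (if b then 1 else 0) := by
      intro x; simp [wordToNat]
    rw [← List.append_assoc, snoc, snoc, ih, List.length_append, List.length_singleton, pow_succ]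
    ring

theorem wordToNat_replicate_false (r : ℕ) : wordToNat (List.replicate r false) = 0 := by
  induction r with
  | zero => simp [wordToNat]
  | succ r ih =>
    rw [List.replicate_succ', wordToNat_append, ih]
    simp [wordToNat]

theorem wordToNat_replicate_true (r : ℕ) : wordToNat (List.replicate r true) = 2 ^ r - 1 := by
  induction r with
  | zero => simp [wordToNat]
  | succ r ih =>
    rw [List.replicate_succ', wordToNat_append, ih]
    have := Nat.one_le_two_pow (n := r)
    simp [wordToNat]
    omega

/-- The word `1 0^z 1^k 1^j 0^s` represents `2^N + (2^(k+j) - 1) 2^s` with `N = z + k + j + s`. -/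
theorem wordToNat_block (z k j s : ℕ) :
    wordToNat (([true] ++ List.replicate z false ++ List.replicate k true) ++
      (List.replicate j true ++ List.replicate s false)) =
      2 ^ (z + k + j + s) + (2 ^ (k + j) - 1) * 2 ^ s := by
  have h : ([true] ++ List.replicate z false ++ List.replicate k true) ++
      (List.replicate j true ++ List.replicate s false) =
      ([true] ++ List.replicate z false) ++ List.replicate (k + j) true ++
        List.replicate s false := by
    simp only [List.replicate_add, List.append_assoc]
  have h1 : wordToNat [true] = 1 := rfl
  rw [h, wordToNat_append, wordToNat_append, wordToNat_append, wordToNat_replicate_false,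
    wordToNat_replicate_false, wordToNat_replicate_true, h1]
  simp only [List.length_replicate]
  ring

theorem block_lt_two_pow {N r s : ℕ} (h : r + s < N) : (2 ^ r - 1) * 2 ^ s < 2 ^ N :=
  calc (2 ^ r - 1) * 2 ^ s < 2 ^ r * 2 ^ s :=
        Nat.mul_lt_mul_of_pos_right (by have := Nat.one_le_two_pow (n := r); omega) (by positivity)
    _ = 2 ^ (r + s) := (pow_add _ _ _).symm
    _ ≤ 2 ^ N := Nat.pow_le_pow_right (by norm_num) h.le

theorem testBit_two_pow_add_block {N r s : ℕ} (h : r + s < N) (i : ℕ) :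
    (2 ^ N + (2 ^ r - 1) * 2 ^ s).testBit i = true ↔ i = N ∨ (s ≤ i ∧ i < s + r) := by
  have hor := Nat.two_pow_add_eq_or_of_lt (block_lt_two_pow h) 1
  rw [mul_one] at hor
  rw [hor, Nat.testBit_or, Nat.testBit_two_pow, Nat.testBit_mul_two_pow,
    Nat.testBit_two_pow_sub_one]
  simp only [Bool.or_eq_true, Bool.and_eq_true, decide_eq_true_eq]
  omega

theorem prod_dig_two (x i l : ℕ) :
    ∏ j ∈ Finset.range l, dig 2 (i + j) x =
      if ∀ j < l, x.testBit (i + j) = true then 1 else 0 := by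
  have hdig : ∀ m, dig 2 m x = if x.testBit m = true then 1 else 0 := by
    intro m
    rw [dig, Nat.testBit_eq_decide_div_mod_eq]
    have := Nat.mod_two_eq_zero_or_one (x / 2 ^ m)
    rcases this with h | h <;> simp [h]
  simp only [hdig]
  rw [Finset.prod_ite_zero]
  simp

/-- In `2^N + (2^r - 1) 2^s` a window of at least two ones lies inside the block of `r` ones. -/
theorem window_block_iff {N r s p : ℕ} (h : r + s < N) (hp : 1 ≤ p) (i : ℕ) :
    (∀ j < p + 1, (2 ^ N + (2 ^ r - 1) * 2 ^ s).testBit (i + j) = true) ↔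
      s ≤ i ∧ i + p < s + r := by
  simp only [testBit_two_pow_add_block h]
  constructor
  · intro H
    have h0 := H 0 (by omega)
    have h1 := H 1 (by omega)
    have h2 := H (p - 1) (by omega)
    have h3 := H p (by omega)
    omega
  · intro H j hj
    omega

theorem log_two_pow_add_block {N r s : ℕ} (h : r + s < N) :
    Nat.log 2 (2 ^ N + (2 ^ r - 1) * 2 ^ s) = N := by
  have := block_lt_two_pow h
  rw [Nat.log_eq_iff (Or.inr ⟨by norm_num, by positivity⟩), pow_succ]
  omega

theorem aP1_block_of_le {P : ℕ → ℕ} {N r s : ℕ} (h : r + s < N) (hp : 1 ≤ P N) (hr : r ≤ P N) :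
    aP1 2 P (2 ^ N + (2 ^ r - 1) * 2 ^ s) = 0 := by
  rw [aP1, log_two_pow_add_block h, aP]
  refine Finset.sum_eq_zero fun i _ => ?_
  rw [prod_dig_two, if_neg]
  rw [window_block_iff h hp]
  omega

theorem aP1_block_of_eq {P : ℕ → ℕ} {N r s : ℕ} (h : r + s < N) (hp : 1 ≤ P N)
    (hr : r = P N + 1) : aP1 2 P (2 ^ N + (2 ^ r - 1) * 2 ^ s) = 1 := by
  rw [aP1, log_two_pow_add_block h, aP, Finset.sum_eq_single s]
  · rw [prod_dig_two, if_pos]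
    rw [window_block_iff h hp]
    omega
  · intro i _ hi
    rw [prod_dig_two, if_neg]
    rw [window_block_iff h hp]
    omega
  · intro hs
    have := Nat.lt_two_pow_self (n := N)
    rw [Finset.mem_range] at hs
    omega

/-- The bound `P n ≤ log n / log 2` in integer form. -/
theorem two_pow_le_of_le_log {p n : ℕ} (hn : 0 < n) (h : (p : ℝ) ≤ Real.log n / Real.log 2) :
    2 ^ p ≤ n := by
  rw [le_div_iff₀ (Real.log_pos (by norm_num)), ← Real.log_pow,
    Real.log_le_log_iff (by positivity) (by exact_mod_cast hn)] at h
  exact_mod_cast h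

/-- Non-automaticity: no finite automaton recognizes the parity of `a_P` (base 2). -/
theorem not_automatic (P : ℕ → ℕ) (hP : Monotone P) (hunb : ∀ B : ℕ, ∃ n, B < P n)
    (hbound : ∀ n : ℕ, 2 ≤ n → (P n : ℝ) ≤ Real.log n / Real.log 2) :
    ¬ ∃ (σ : Type) (_ : Fintype σ) (M : DFA Bool σ),
        ∀ w : List Bool, w ∈ M.accepts ↔ Even (aP1 2 P (wordToNat w)) := by
  rintro ⟨σ, _, M, hM⟩
  obtain ⟨N, hN⟩ := hunb (Fintype.card σ + 3)
  have hN2 : 2 ≤ N := by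
    by_contra hlt
    have h2 : 2 ^ P 2 ≤ 2 := two_pow_le_of_le_log (by norm_num) (hbound 2 le_rfl)
    have h3 := hP (show N ≤ 2 by omega)
    have h4 := Nat.lt_two_pow_self (n := P 2)
    omega
  have hpow := two_pow_le_of_le_log (by omega) (hbound N hN2)
  obtain ⟨p, hp⟩ : ∃ p, p = P N := ⟨_, rfl⟩
  rw [← hp] at hpow hN
  have hNp : 2 * p + 1 ≤ N := by
    refine le_trans ?_ hpow
    obtain ⟨t, rfl⟩ := Nat.exists_eq_add_of_le (show 3 ≤ p by omega)
    have := Nat.lt_two_pow_self (n := t)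
    rw [pow_add]
    omega
  let u : ℕ → List Bool := fun k =>
    [true] ++ List.replicate (p + 1 - k) false ++ List.replicate k true
  obtain ⟨a, b, hab, heq⟩ := Fintype.exists_ne_map_eq_of_card_lt
    (fun k : Fin (p + 1) => M.eval (u k)) (by rw [Fintype.card_fin]; omega)
  wlog hlt : a < b generalizing a b
  · exact this b a hab.symm heq.symm (lt_of_le_of_ne (not_lt.mp hlt) hab.symm)
  have ha := a.isLt
  have hb := b.isLt
  have hlt' : (a : ℕ) < b := hlt
  let j := p + 1 - (b : ℕ)
  let s := N - (p + 1) - j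
  let v := List.replicate j true ++ List.replicate s false
  have hacc : u a ++ v ∈ M.accepts ↔ u b ++ v ∈ M.accepts := by
    rw [DFA.mem_accepts, DFA.mem_accepts, DFA.eval,
      M.evalFrom_of_append M.start (u a) v, M.evalFrom_of_append M.start (u b) v]
    have heq' : M.evalFrom M.start (u a) = M.evalFrom M.start (u b) := heq
    rw [heq']
  rw [hM, hM, wordToNat_block, wordToNat_block,
    show p + 1 - (a : ℕ) + a + j + s = N by omega,
    show p + 1 - (b : ℕ) + b + j + s = N by omega,
    aP1_block_of_le (by omega) (by omega) (by omega),
    aP1_block_of_eq (by omega) (by omega) (by omega)] at hacc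
  simp at hacc
end
end

section
/- For integers k ≥ 0 and m ≥ 1, let E_k(m) denote the number of integers u with 0 ≤ u < m such that b_k(u) := ∑_{i≥0} ε_{i+k}(u)·ε_{i+k−1}(u)⋯ε_i(u) is even (where ε_i are binary digits), and I_k(m) the number of such u with b_k(u) odd. Then for every real A > 1 and every δ > 0 there exists N₀ such that for all integers N ≥ N₀ and all integers k with k ≥ A·log N/log 2, one has E_k(2^N) ≥ 2^N·(1 − (2+δ)·N^{1−A}) and I_k(2^N) ≤ (2+δ)·N^{1−A}·2^N. -/
open Finset

open scoped Classical

noncomputable section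

/-- `b_k(u) = ∑_{i ≥ 0} ε_{i+k}(u) ⋯ ε_i(u)`: number of occurrences of `k+1`
consecutive ones in the binary expansion of `u`. -/
def bk (k u : ℕ) : ℕ := ∑ i ∈ Finset.range (u + 1), ∏ j ∈ Finset.range (k + 1), dig 2 (i + j) u

theorem dig_two_ne_zero_iff_testBit (i u : ℕ) : dig 2 i u ≠ 0 ↔ u.testBit i = true := by
  rw [dig, Nat.testBit_eq_decide_div_mod_eq, decide_eq_true_iff]
  omega

/-- A nonzero `b_k(u)` with `u < 2 ^ N` yields a block of `k + 1` ones inside the first `N` digits. -/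
theorem exists_block_of_bk_ne_zero {N k u : ℕ} (hu : u < 2 ^ N) (h : bk k u ≠ 0) :
    ∃ i, i + k < N ∧ ∀ j < k + 1, u.testBit (i + j) = true := by
  obtain ⟨i, -, hi⟩ := Finset.exists_ne_zero_of_sum_ne_zero h
  rw [Finset.prod_ne_zero_iff] at hi
  have hbits : ∀ j < k + 1, u.testBit (i + j) = true := fun j hj =>
    (dig_two_ne_zero_iff_testBit _ _).1 (hi j (Finset.mem_range.2 hj))
  refine ⟨i, ?_, hbits⟩
  by_contra! hN
  have h1 := hbits k (Nat.lt_succ_self k)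
  rw [Nat.testBit_eq_false_of_lt (hu.trans_le (Nat.pow_le_pow_right two_pos hN))] at h1
  exact Bool.false_ne_true h1

/-- At most `2 ^ (N - (k + 1))` integers below `2 ^ N` have ones at positions `i, …, i + k`. -/
theorem card_block_le {N k i : ℕ} (hi : i + k < N) :
    #{u ∈ range (2 ^ N) | ∀ j < k + 1, u.testBit (i + j) = true} ≤ 2 ^ (N - (k + 1)) := by
  have hcard : #(range (2 ^ i) ×ˢ range (2 ^ (N - (i + k + 1)))) = 2 ^ (N - (k + 1)) := by
    rw [Finset.card_product, Finset.card_range, Finset.card_range, ← pow_add]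
    congr 1
    omega
  rw [← hcard]
  refine Finset.card_le_card_of_injOn (fun u => (u % 2 ^ i, u / 2 ^ (i + k + 1))) ?_ ?_
  · intro u hu
    simp only [Finset.coe_filter, Finset.mem_range, Set.mem_ofPred_eq] at hu
    simp only [Finset.coe_product, Finset.coe_range, Set.mem_prod, Set.mem_Iio]
    refine ⟨Nat.mod_lt _ (by positivity), Nat.div_lt_of_lt_mul ?_⟩
    rw [← pow_add, Nat.add_sub_cancel' (by omega)]
    exact hu.1
  · intro u hu v hv huv
    simp only [Finset.coe_filter, Finset.mem_range, Set.mem_ofPred_eq] at hu hv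
    obtain ⟨hmod, hdiv⟩ := Prod.mk.inj huv
    refine Nat.eq_of_testBit_eq fun j => ?_
    rcases lt_or_ge j i with hj | hj
    · simpa [Nat.testBit_mod_two_pow, hj] using congrArg (fun w => w.testBit j) hmod
    obtain ⟨l, rfl⟩ := Nat.exists_eq_add_of_le hj
    rcases lt_or_ge l (k + 1) with hl | hl
    · rw [hu.2 l hl, hv.2 l hl]
    obtain ⟨m, rfl⟩ := Nat.exists_eq_add_of_le hl
    have h := congrArg (fun w => w.testBit m) hdiv
    simp only [Nat.testBit_div_two_pow] at h
    rwa [show i + (k + 1 + m) = m + (i + k + 1) by ring]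

/-- Union bound: the proportion of `u < 2 ^ N` with `b_k(u)` odd is at most `N / 2 ^ (k + 1)`. -/
theorem card_odd_bk_mul_le (N k : ℕ) :
    #{u ∈ range (2 ^ N) | Odd (bk k u)} * 2 ^ (k + 1) ≤ N * 2 ^ N := by
  have hsub : {u ∈ range (2 ^ N) | Odd (bk k u)} ⊆ (range (N - k)).biUnion fun i =>
      {u ∈ range (2 ^ N) | ∀ j < k + 1, u.testBit (i + j) = true} := by
    intro u hu
    rw [Finset.mem_filter, Finset.mem_range] at hu
    obtain ⟨i, hi, hbits⟩ := exists_block_of_bk_ne_zero hu.1 hu.2.pos.ne'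
    rw [Finset.mem_biUnion]
    exact ⟨i, Finset.mem_range.2 (by omega),
      Finset.mem_filter.2 ⟨Finset.mem_range.2 hu.1, hbits⟩⟩
  have hle : #{u ∈ range (2 ^ N) | Odd (bk k u)} ≤ (N - k) * 2 ^ (N - (k + 1)) := by
    refine (Finset.card_le_card hsub).trans ((Finset.card_biUnion_le_card_mul _ _ _ ?_).trans_eq
      (by rw [Finset.card_range]))
    intro i hi
    rw [Finset.mem_range] at hi
    exact card_block_le (by omega)
  rcases le_or_gt N k with hNk | hNk
  · rw [Nat.sub_eq_zero_of_le hNk, zero_mul, Nat.le_zero] at hle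
    rw [hle, zero_mul]
    exact Nat.zero_le _
  · calc _ ≤ (N - k) * 2 ^ (N - (k + 1)) * 2 ^ (k + 1) := Nat.mul_le_mul_right _ hle
      _ = (N - k) * 2 ^ N := by rw [mul_assoc, ← pow_add, Nat.sub_add_cancel hNk]
      _ ≤ N * 2 ^ N := Nat.mul_le_mul_right _ (Nat.sub_le _ _)

/-- Most integers below `2^N` have an even number of blocks of `k+1` consecutive ones,
when `k ≥ A log N / log 2` with `A > 1`. -/
theorem even_blocks_dominate :
    ∀ A : ℝ, 1 < A → ∀ δ : ℝ, 0 < δ → ∃ N₀ : ℕ, ∀ N : ℕ, N₀ ≤ N →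
    ∀ k : ℕ, A * Real.log N / Real.log 2 ≤ (k : ℝ) →
      (2 : ℝ) ^ N * (1 - (2 + δ) * (N : ℝ) ^ ((1 : ℝ) - A)) ≤
          (((Finset.range (2 ^ N)).filter (fun u => Even (bk k u))).card : ℝ) ∧
        (((Finset.range (2 ^ N)).filter (fun u => Odd (bk k u))).card : ℝ) ≤
          (2 + δ) * (N : ℝ) ^ ((1 : ℝ) - A) * (2 : ℝ) ^ N := by
  intro A _ δ hδ
  refine ⟨1, fun N hN k hk => ?_⟩
  have hN0 : (0 : ℝ) < N := by exact_mod_cast hN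
  have hpow : (N : ℝ) ^ A ≤ 2 ^ k := by
    rw [div_le_iff₀ (Real.log_pos one_lt_two)] at hk
    rw [← Real.log_le_log_iff (by positivity) (by positivity), Real.log_rpow hN0, Real.log_pow]
    exact hk
  have hodd : (#{u ∈ range (2 ^ N) | Odd (bk k u)} : ℝ) ≤
      (2 + δ) * (N : ℝ) ^ ((1 : ℝ) - A) * (2 : ℝ) ^ N := by
    have hcard : (#{u ∈ range (2 ^ N) | Odd (bk k u)} : ℝ) * 2 ^ (k + 1) ≤ N * 2 ^ N := by
      exact_mod_cast card_odd_bk_mul_le N k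
    have hmul : (#{u ∈ range (2 ^ N) | Odd (bk k u)} : ℝ) * (N : ℝ) ^ A ≤ N * 2 ^ N := by
      refine le_trans ?_ hcard
      gcongr
      exact hpow.trans (pow_le_pow_right₀ one_le_two (Nat.le_succ k))
    rw [← le_div_iff₀ (by positivity)] at hmul
    calc _ ≤ (N : ℝ) * 2 ^ N / (N : ℝ) ^ A := hmul
      _ = 1 * (N : ℝ) ^ ((1 : ℝ) - A) * (2 : ℝ) ^ N := by
        rw [Real.rpow_sub hN0, Real.rpow_one]
        ring
      _ ≤ _ := by
        gcongr
        linarith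
  refine ⟨?_, hodd⟩
  have hsum : (#{u ∈ range (2 ^ N) | Even (bk k u)} : ℝ) + #{u ∈ range (2 ^ N) | Odd (bk k u)} =
      2 ^ N := by
    have h := Finset.card_filter_add_card_filter_not (s := range (2 ^ N)) (fun u => Even (bk k u))
    simp only [Nat.not_even_iff_odd, Finset.card_range] at h
    exact_mod_cast h
  linarith
end
end

section
/- Let q ≥ 2 and let λ, κ be nonnegative integers. Then the set of integers l with 0 ≤ l < q^λ for which there exist integers k₁, k₂ with 0 ≤ k₁, k₂ < q^κ and T_q(l·q^κ + k₁ + k₂) ≠ T_q(l·q^κ + k₁) has cardinality at most λ + 1; indeed every such l belongs to {0} ∪ {q^j − 1 : 1 ≤ j ≤ λ}. -/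
open Finset

open scoped Classical

noncomputable section

/-- If `l + 1` has as many base-`q` digits as `l`, then every
`n` between `l * q ^ k` and `(l + 2) * q ^ k` has `k` more digits than `l`. -/
theorem log_eq_of_mul_pow_le_of_lt {q l k n : ℕ} (hl : l ≠ 0)
    (hl' : l + 2 ≤ q ^ (Nat.log q l + 1)) (hn : l * q ^ k ≤ n) (hn' : n < (l + 2) * q ^ k) :
    Nat.log q n = Nat.log q l + k := by
  refine Nat.log_eq_of_pow_le_of_lt_pow ?_ ?_
  · calc q ^ (Nat.log q l + k) = q ^ Nat.log q l * q ^ k := pow_add ..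
      _ ≤ l * q ^ k := Nat.mul_le_mul_right _ (Nat.pow_log_le_self q hl)
      _ ≤ n := hn
  · calc n < (l + 2) * q ^ k := hn'
      _ ≤ q ^ (Nat.log q l + 1) * q ^ k := Nat.mul_le_mul_right _ hl'
      _ = q ^ (Nat.log q l + k + 1) := by ring

/-- If adding `k₂ < q ^ kap` changes the number of digits of `l * q ^ kap + k₁`, then `l` is zero
or all its digits are `q - 1`. -/
theorem eq_zero_or_eq_pow_sub_one_of_log_ne {q lam kap l k₁ k₂ : ℕ} (hq : 2 ≤ q)
    (hl : l < q ^ lam) (hk₁ : k₁ < q ^ kap) (hk₂ : k₂ < q ^ kap)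
    (h : Nat.log q (l * q ^ kap + k₁ + k₂) ≠ Nat.log q (l * q ^ kap + k₁)) :
    l = 0 ∨ ∃ j, 1 ≤ j ∧ j ≤ lam ∧ l = q ^ j - 1 := by
  refine or_iff_not_imp_left.2 fun h0 => ⟨Nat.log q l + 1, by omega, ?_, ?_⟩
  · exact Nat.log_lt_of_lt_pow h0 hl
  · have hlt : l < q ^ (Nat.log q l + 1) := Nat.lt_pow_succ_log_self (by omega) l
    by_contra hne
    have hl' : l + 2 ≤ q ^ (Nat.log q l + 1) := by omega
    have hmul : (l + 2) * q ^ kap = l * q ^ kap + 2 * q ^ kap := add_mul ..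
    have hlog : ∀ n, l * q ^ kap ≤ n → n < (l + 2) * q ^ kap → Nat.log q n = Nat.log q l + kap :=
      fun n => log_eq_of_mul_pow_le_of_lt h0 hl'
    exact h ((hlog _ (by omega) (by omega)).trans (hlog _ (by omega) (by omega)).symm)

/-- The number of `l < q^λ` for which adding `k₁ + k₂ < 2 q^κ` can change the number of
digits of `l q^κ + k₁` is at most `λ + 1`; such `l` are `0` or of the form `q^j - 1`. -/
theorem digit_length_change (q : ℕ) (hq : 2 ≤ q) (lam kap : ℕ) :
    ({l : ℕ | l < q ^ lam ∧ ∃ k₁ < q ^ kap, ∃ k₂ < q ^ kap,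
        Nat.log q (l * q ^ kap + k₁ + k₂) ≠ Nat.log q (l * q ^ kap + k₁)}.ncard ≤ lam + 1) ∧
      ∀ l < q ^ lam,
        (∃ k₁ < q ^ kap, ∃ k₂ < q ^ kap,
          Nat.log q (l * q ^ kap + k₁ + k₂) ≠ Nat.log q (l * q ^ kap + k₁)) →
        l = 0 ∨ ∃ j, 1 ≤ j ∧ j ≤ lam ∧ l = q ^ j - 1 := by
  have key : ∀ l < q ^ lam,
      (∃ k₁ < q ^ kap, ∃ k₂ < q ^ kap,
        Nat.log q (l * q ^ kap + k₁ + k₂) ≠ Nat.log q (l * q ^ kap + k₁)) →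
      l = 0 ∨ ∃ j, 1 ≤ j ∧ j ≤ lam ∧ l = q ^ j - 1 := by
    rintro l hl ⟨k₁, hk₁, k₂, hk₂, h⟩
    exact eq_zero_or_eq_pow_sub_one_of_log_ne hq hl hk₁ hk₂ h
  refine ⟨?_, key⟩
  calc _ ≤ (((range (lam + 1)).image fun j => q ^ j - 1 : Finset ℕ) : Set ℕ).ncard := by
        refine Set.ncard_le_ncard ?_ (Finset.finite_toSet _)
        rintro l ⟨hl, h⟩
        rw [mem_coe, mem_image]
        rcases key l hl h with rfl | ⟨j, -, hj, rfl⟩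
        · exact ⟨0, by simp, by simp⟩
        · exact ⟨j, by simpa [Nat.lt_succ_iff] using hj, rfl⟩
    _ ≤ lam + 1 := by
        rw [Set.ncard_coe_finset]
        exact card_image_le.trans (card_range _).le
end
end
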